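/- Let α, β > 0 and let ν₁ be the Borel measure on ℝ² with density (s,u) ↦ g_γ(s)·p₁(s,u) with respect to Lebesgue measure. Then ν₁ is a Lévy measure on ℝ², i.e. ∫_{ℝ²} min(1, s² + u²) dν₁(s,u) < +∞; moreover ∫_{ℝ²} s² dν₁(s,u) < +∞ and ∫_{ℝ²} u² dν₁(s,u) = α/β. -/

import Mathlib

open MeasureTheory ProbabilityTheory Real Set

/-- The Gamma Lévy density `g_γ(s) = (α/s)·e^{−βs}` for `s > 0`, `0` otherwise. -/
noncomputable def gGamma (α β : ℝ) (s : ℝ) : ℝ :=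
  if 0 < s then (α / s) * Real.exp (-β * s) else 0

/-- The one-dimensional heat kernel `p₁(s,u) = (2πs)^{−1/2}·e^{−u²/(2s)}` for `s > 0`. -/
noncomputable def p1 (s u : ℝ) : ℝ :=
  if 0 < s then (Real.sqrt (2 * Real.pi * s))⁻¹ * Real.exp (-(u ^ 2) / (2 * s)) else 0

/-- The measure `ν₁` on `ℝ²` with density `(s,u) ↦ g_γ(s)·p₁(s,u)` w.r.t. Lebesgue measure. -/
noncomputable def nu1 (α β : ℝ) : Measure (ℝ × ℝ) :=
  (volume : Measure (ℝ × ℝ)).withDensity fun q => ENNReal.ofReal (gGamma α β q.1 * p1 q.1 q.2)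

theorem measurable_gGamma (α β : ℝ) : Measurable (gGamma α β) :=
  Measurable.ite measurableSet_Ioi (by fun_prop) measurable_const

theorem measurable_p1 : Measurable fun q : ℝ × ℝ => p1 q.1 q.2 :=
  Measurable.ite (measurableSet_lt measurable_const measurable_fst) (by fun_prop) measurable_const

theorem gGamma_nonneg {α : ℝ} (hα : 0 ≤ α) (β s : ℝ) : 0 ≤ gGamma α β s := by
  unfold gGamma
  split_ifs <;> positivity

theorem ofReal_p1_eq_gaussianPDF {s : ℝ} (hs : 0 < s) (u : ℝ) :
    ENNReal.ofReal (p1 s u) = gaussianPDF 0 s.toNNReal u := by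
  simp [p1, gaussianPDF, gaussianPDFReal, hs, hs.le]

/-- Disintegration of `ν₁` along the first coordinate: given `s`, the second coordinate is a
centred Gaussian of variance `s`. -/
theorem lintegral_nu1 {α : ℝ} (hα : 0 ≤ α) (β : ℝ) {f : ℝ × ℝ → ENNReal} (hf : Measurable f) :
    ∫⁻ q, f q ∂nu1 α β =
      ∫⁻ s in Ioi 0, ENNReal.ofReal (α / s * Real.exp (-β * s)) *
        ∫⁻ u, f (s, u) ∂gaussianReal 0 s.toNNReal := by
  have hd : Measurable fun q : ℝ × ℝ => ENNReal.ofReal (gGamma α β q.1 * p1 q.1 q.2) :=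
    (((measurable_gGamma α β).comp measurable_fst).mul measurable_p1).ennreal_ofReal
  rw [nu1, lintegral_withDensity_eq_lintegral_mul _ hd hf, Measure.volume_eq_prod,
    lintegral_prod _ (hd.mul hf).aemeasurable, ← lintegral_indicator measurableSet_Ioi]
  refine lintegral_congr fun s => ?_
  by_cases hs : 0 < s
  · have hv : s.toNNReal ≠ 0 := by simpa using hs
    have hfs : Measurable fun u => f (s, u) := hf.comp measurable_prodMk_left
    rw [indicator_of_mem (mem_Ioi.2 hs), gaussianReal_of_var_ne_zero 0 hv,
      lintegral_withDensity_eq_lintegral_mul _ (measurable_gaussianPDF 0 _) hfs,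
      ← lintegral_const_mul _ ((measurable_gaussianPDF 0 _).mul hfs)]
    refine lintegral_congr fun u => ?_
    simp only [Pi.mul_apply]
    rw [ENNReal.ofReal_mul (gGamma_nonneg hα β s), ofReal_p1_eq_gaussianPDF hs, mul_assoc]
    simp [gGamma, hs]
  · simp [gGamma, hs]

theorem lintegral_sq_gaussianReal (v : NNReal) :
    ∫⁻ u, ENNReal.ofReal (u ^ 2) ∂gaussianReal 0 v = v := by
  have h := (memLp_id_gaussianReal (μ := 0) (v := v) 2).ofReal_variance_eq
  rw [variance_id_gaussianReal, evariance_eq_lintegral_ofReal] at h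
  simpa [integral_id_gaussianReal] using h.symm

/-- The second moment of the Gaussian coordinate of `ν₁`. -/
theorem lintegral_snd_sq_nu1 {α β : ℝ} (hα : 0 ≤ α) (hβ : 0 < β) :
    ∫⁻ q : ℝ × ℝ, ENNReal.ofReal (q.2 ^ 2) ∂nu1 α β = ENNReal.ofReal (α / β) := by
  rw [lintegral_nu1 hα β (by fun_prop)]
  have hint : IntegrableOn (fun s => α * Real.exp (-β * s)) (Ioi 0) :=
    (integrableOn_exp_mul_Ioi (neg_lt_zero.2 hβ) 0).const_mul α
  have hval : ∫ s in Ioi (0 : ℝ), α * Real.exp (-β * s) = α / β := by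
    rw [integral_const_mul, integral_exp_mul_Ioi (neg_lt_zero.2 hβ)]
    simp [div_eq_mul_inv]
  rw [← hval, ofReal_integral_eq_lintegral_ofReal hint (ae_of_all _ fun s => by positivity)]
  refine setLIntegral_congr_fun measurableSet_Ioi fun s (hs : 0 < s) => ?_
  simp only [lintegral_sq_gaussianReal]
  rw [← ENNReal.ofReal, ← ENNReal.ofReal_mul (by positivity)]
  congr 1
  field_simp

/-- The second moment of the Gamma coordinate of `ν₁` is finite. -/
theorem lintegral_fst_sq_nu1_lt_top {α β : ℝ} (hα : 0 ≤ α) (hβ : 0 < β) :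
    ∫⁻ q : ℝ × ℝ, ENNReal.ofReal (q.1 ^ 2) ∂nu1 α β < ⊤ := by
  rw [lintegral_nu1 hα β (by fun_prop)]
  have hint : IntegrableOn (fun s => α * (s ^ (1 : ℝ) * Real.exp (-β * s ^ (1 : ℝ)))) (Ioi 0) :=
    (integrableOn_rpow_mul_exp_neg_mul_rpow (by norm_num) one_pos hβ).const_mul α
  refine lt_of_eq_of_lt (setLIntegral_congr_fun measurableSet_Ioi fun s (hs : 0 < s) => ?_)
    hint.lintegral_lt_top
  simp only [lintegral_const, measure_univ, mul_one, Real.rpow_one]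
  rw [← ENNReal.ofReal_mul (by positivity)]
  congr 1
  field_simp

/-- `ν₁` is a Lévy measure on `ℝ²`: `∫_{ℝ²} min(1, s² + u²) dν₁(s,u) < ∞`; moreover
`∫_{ℝ²} s² dν₁(s,u) < ∞` and `∫_{ℝ²} u² dν₁(s,u) = α/β`. -/
theorem nu1_is_levy_measure (α β : ℝ) (hα : 0 < α) (hβ : 0 < β) :
    (∫⁻ q : ℝ × ℝ, ENNReal.ofReal (min 1 (q.1 ^ 2 + q.2 ^ 2)) ∂nu1 α β) < ⊤ ∧
    (∫⁻ q : ℝ × ℝ, ENNReal.ofReal (q.1 ^ 2) ∂nu1 α β) < ⊤ ∧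
    (∫⁻ q : ℝ × ℝ, ENNReal.ofReal (q.2 ^ 2) ∂nu1 α β) = ENNReal.ofReal (α / β) := by
  have hfst := lintegral_fst_sq_nu1_lt_top hα.le hβ
  have hsnd := lintegral_snd_sq_nu1 hα.le hβ
  refine ⟨?_, hfst, hsnd⟩
  calc ∫⁻ q : ℝ × ℝ, ENNReal.ofReal (min 1 (q.1 ^ 2 + q.2 ^ 2)) ∂nu1 α β
      ≤ ∫⁻ q : ℝ × ℝ, (ENNReal.ofReal (q.1 ^ 2) + ENNReal.ofReal (q.2 ^ 2)) ∂nu1 α β :=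
        lintegral_mono fun q =>
          (ENNReal.ofReal_le_ofReal (min_le_right _ _)).trans ENNReal.ofReal_add_le
    _ = ∫⁻ q : ℝ × ℝ, ENNReal.ofReal (q.1 ^ 2) ∂nu1 α β
        + ∫⁻ q : ℝ × ℝ, ENNReal.ofReal (q.2 ^ 2) ∂nu1 α β :=
        lintegral_add_left (by fun_prop) _
    _ < ⊤ := by
        rw [hsnd]
        exact ENNReal.add_lt_top.2 ⟨hfst, ENNReal.ofReal_lt_top⟩
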